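/- (Modified CRB-type bound.) Consider the SLGM and assume every set of at most S columns of H is linearly independent (spark(H) > S). Let x₀ ∈ X_S and let K ⊆ {1,…,N} be nonempty with |K| ≤ S, so that H_Kᵀ H_K is invertible. Define P = H_K (H_Kᵀ H_K)^{−1} H_Kᵀ ∈ ℝ^{M×M} and the vector x̃₀ ∈ ℝ^N whose entries indexed by K are given by (H_Kᵀ H_K)^{−1} H_Kᵀ (H x₀) and whose other entries are 0. Let ĝ : ℝ^M → ℝ be Borel measurable, P_x-integrable for every x ∈ X_S, with ∫ ĝ² dP_{x₀} < ∞; write γ(x) = ∫ ĝ dP_x for x ∈ X_S. Suppose that for each l ∈ K the map t ↦ γ(x̃₀ + t e_l) is differentiable at t = 0, with derivative b_l; set b = (b_l)_{l∈K} ∈ ℝ^K. Then v(ĝ; x₀) ≥ exp(−‖(I − P) H x₀‖₂²/σ²) · σ² · bᵀ (H_Kᵀ H_K)^{−1} b. -/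

import Mathlib

open Matrix MeasureTheory ProbabilityTheory

/-- The distribution `P_x` of `y = Hx + n` where `n` has i.i.d. `N(0,σ²)` entries. -/
noncomputable def slgmP {M N : ℕ} (H : Matrix (Fin M) (Fin N) ℝ) (σ : ℝ)
    (x : Fin N → ℝ) : Measure (Fin M → ℝ) :=
  Measure.map (fun n => H.mulVec x + n)
    (Measure.pi fun _ : Fin M => gaussianReal 0 ((σ ^ 2).toNNReal))

/-- The set `X_S` of `S`-sparse parameter vectors. -/
def sparseSet (N S : ℕ) : Set (Fin N → ℝ) := {x | (Function.support x).ncard ≤ S}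

/-- Mean function `γ_ĝ(x) = ∫ ĝ dP_x` of an estimator. -/
noncomputable def slgmMean {M N : ℕ} (H : Matrix (Fin M) (Fin N) ℝ) (σ : ℝ)
    (g : (Fin M → ℝ) → ℝ) (x : Fin N → ℝ) : ℝ := ∫ y, g y ∂ slgmP H σ x

/-- Variance `v(ĝ;x) = ∫ (ĝ(y) − γ_ĝ(x))² dP_x(y)` of an estimator. -/
noncomputable def slgmVar {M N : ℕ} (H : Matrix (Fin M) (Fin N) ℝ) (σ : ℝ)
    (g : (Fin M → ℝ) → ℝ) (x : Fin N → ℝ) : ℝ :=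
  ∫ y, (g y - slgmMean H σ g x) ^ 2 ∂ slgmP H σ x

/-- The submatrix `H_K` of the columns of `H` indexed by `K`. -/
def Hsub {M N : ℕ} (H : Matrix (Fin M) (Fin N) ℝ) (K : Finset (Fin N)) :
    Matrix (Fin M) ↥K ℝ := Matrix.of fun m k => H m k.1

/-- The Gram matrix `H_Kᵀ H_K`. -/
noncomputable def gramK {M N : ℕ} (H : Matrix (Fin M) (Fin N) ℝ) (K : Finset (Fin N)) :
    Matrix ↥K ↥K ℝ := (Hsub H K)ᵀ * Hsub H K

/-- The orthogonal projection matrix `P = H_K (H_Kᵀ H_K)⁻¹ H_Kᵀ`. -/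
noncomputable def projK {M N : ℕ} (H : Matrix (Fin M) (Fin N) ℝ) (K : Finset (Fin N)) :
    Matrix (Fin M) (Fin M) ℝ := Hsub H K * (gramK H K)⁻¹ * (Hsub H K)ᵀ

/-- The vector `x̃₀`: entries indexed by `K` equal `(H_Kᵀ H_K)⁻¹ H_Kᵀ (H x₀)`, other
entries are `0`; so `supp(x̃₀) ⊆ K` and `H x̃₀ = P H x₀`. -/
noncomputable def xtilde {M N : ℕ} (H : Matrix (Fin M) (Fin N) ℝ) (K : Finset (Fin N))
    (x₀ : Fin N → ℝ) : Fin N → ℝ :=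
  fun l => if h : l ∈ K then
    ((gramK H K)⁻¹ * (Hsub H K)ᵀ).mulVec (H.mulVec x₀) ⟨l, h⟩ else 0

lemma gaussianReal_eq_withDensity_zero (u : ℝ) {v : NNReal} (hv : v ≠ 0) :
    gaussianReal u v = (gaussianReal 0 v).withDensity
      (fun x => ENNReal.ofReal (Real.exp ((u * x - u ^ 2 / 2) / v))) := by
  rw [gaussianReal_of_var_ne_zero _ hv, gaussianReal_of_var_ne_zero _ hv,
    ← withDensity_mul _ (measurable_gaussianPDF 0 v) (by fun_prop)]
  congr 1
  ext x
  simp only [Pi.mul_apply, gaussianPDF]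
  rw [← ENNReal.ofReal_mul (gaussianPDFReal_nonneg _ _ _)]
  congr 1
  have hv' : (v : ℝ) ≠ 0 := by exact_mod_cast hv
  simp only [gaussianPDFReal]
  rw [mul_assoc _ (Real.exp _), ← Real.exp_add]
  congr 2
  field_simp
  ring

lemma integrable_exp_sum_mul_gaussian {ι : Type*} [Fintype ι] (w : ι → ℝ) (v : NNReal) :
    Integrable (fun n : ι → ℝ => Real.exp (∑ i, w i * n i))
      (Measure.pi fun _ : ι => gaussianReal 0 v) := by
  simp_rw [Real.exp_sum]
  exact Integrable.fintype_prod (f := fun i x => Real.exp (w i * x))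
    (fun i => integrable_exp_mul_gaussianReal (w i))

lemma integral_exp_sum_mul_gaussian {ι : Type*} [Fintype ι] (w : ι → ℝ) (v : NNReal) :
    ∫ n, Real.exp (∑ i, w i * n i) ∂(Measure.pi fun _ : ι => gaussianReal 0 v) =
      Real.exp (v * (∑ i, w i ^ 2) / 2) := by
  simp_rw [Real.exp_sum]
  rw [integral_fintype_prod_eq_prod (f := fun i x => Real.exp (w i * x))]
  have h : ∀ i, ∫ x, Real.exp (w i * x) ∂gaussianReal 0 v = Real.exp (v * w i ^ 2 / 2) := by
    intro i
    have := congrFun (mgf_id_gaussianReal (μ := 0) (v := v)) (w i)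
    simpa [mgf] using this
  simp_rw [h]
  rw [← Real.exp_sum, Finset.mul_sum, Finset.sum_div]

/-- The likelihood ratio of the Gaussian shifted by `u` with respect to the centred one. -/
noncomputable def gaussianShiftDensity {ι : Type*} [Fintype ι] (v : NNReal) (u n : ι → ℝ) : ℝ :=
  Real.exp (∑ i, (u i * n i - u i ^ 2 / 2) / v)

lemma measurable_gaussianShiftDensity {ι : Type*} [Fintype ι] (v : NNReal) (u : ι → ℝ) :
    Measurable (gaussianShiftDensity v u) := by
  unfold gaussianShiftDensity; fun_prop

lemma gaussianShiftDensity_mul {ι : Type*} [Fintype ι] (v : NNReal) (u w n : ι → ℝ) :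
    gaussianShiftDensity v u n * gaussianShiftDensity v w n =
      Real.exp (-∑ i, (u i ^ 2 + w i ^ 2) / 2 / v) *
        Real.exp (∑ i, ((u i + w i) / v) * n i) := by
  rw [gaussianShiftDensity, gaussianShiftDensity, ← Real.exp_add, ← Real.exp_add,
    ← Finset.sum_add_distrib, ← Finset.sum_neg_distrib, ← Finset.sum_add_distrib]
  congr 1
  exact Finset.sum_congr rfl fun i _ => by ring

lemma memLp_gaussianShiftDensity {ι : Type*} [Fintype ι] (v : NNReal) (u : ι → ℝ) :
    MemLp (gaussianShiftDensity v u) 2 (Measure.pi fun _ : ι => gaussianReal 0 v) := by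
  rw [memLp_two_iff_integrable_sq (measurable_gaussianShiftDensity v u).aestronglyMeasurable]
  simp_rw [sq, gaussianShiftDensity_mul]
  exact (integrable_exp_sum_mul_gaussian _ v).const_mul _

lemma integral_gaussianShiftDensity_mul {ι : Type*} [Fintype ι] {v : NNReal} (hv : v ≠ 0)
    (u w : ι → ℝ) :
    ∫ n, gaussianShiftDensity v u n * gaussianShiftDensity v w n
      ∂(Measure.pi fun _ : ι => gaussianReal 0 v) = Real.exp ((u ⬝ᵥ w) / v) := by
  have hv' : (v : ℝ) ≠ 0 := by exact_mod_cast hv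
  simp_rw [gaussianShiftDensity_mul]
  rw [integral_const_mul, integral_exp_sum_mul_gaussian, ← Real.exp_add, dotProduct,
    Finset.mul_sum, Finset.sum_div, Finset.sum_div, ← Finset.sum_neg_distrib,
    ← Finset.sum_add_distrib]
  congr 1
  exact Finset.sum_congr rfl fun i _ => by field_simp; ring

lemma integrable_exp_shift_gaussianReal (u : ℝ) (v : NNReal) :
    Integrable (fun x => Real.exp ((u * x - u ^ 2 / 2) / v)) (gaussianReal 0 v) := by
  convert (integrable_exp_mul_gaussianReal (μ := 0) (v := v) (u / v)).const_mul
    (Real.exp (-(u ^ 2 / 2 / v))) using 2 with x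
  rw [← Real.exp_add]
  ring_nf

lemma map_add_pi_gaussianReal {ι : Type*} [Fintype ι] {v : NNReal} (hv : v ≠ 0) (u : ι → ℝ) :
    (Measure.pi fun _ : ι => gaussianReal 0 v).map (fun n => u + n) =
      (Measure.pi fun _ : ι => gaussianReal 0 v).withDensity
        (fun n => ENNReal.ofReal (gaussianShiftDensity v u n)) := by
  have h1 : (Measure.pi fun _ : ι => gaussianReal 0 v).map (fun n => u + n) =
      Measure.pi fun i => gaussianReal (u i) v := by
    have := Measure.pi_map_pi (μ := fun _ : ι => gaussianReal 0 v) (f := fun i x => u i + x)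
      (fun i => by fun_prop)
    simp_rw [gaussianReal_map_const_add, zero_add] at this
    exact this
  rw [h1]
  refine Measure.pi_eq fun s hs => ?_
  rw [withDensity_apply _ (MeasurableSet.univ_pi hs), Measure.restrict_pi_pi]
  simp_rw [gaussianShiftDensity, Real.exp_sum]
  rw [← ofReal_integral_eq_lintegral_ofReal, integral_fintype_prod_eq_prod
    (f := fun i x => Real.exp ((u i * x - u i ^ 2 / 2) / v)),
    ENNReal.ofReal_prod_of_nonneg (fun i _ => integral_nonneg fun x => (Real.exp_pos _).le)]
  · refine Finset.prod_congr rfl fun i _ => ?_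
    rw [gaussianReal_eq_withDensity_zero (u i) hv, withDensity_apply _ (hs i),
      ofReal_integral_eq_lintegral_ofReal _ (ae_of_all _ fun x => (Real.exp_pos _).le)]
    exact (integrable_exp_shift_gaussianReal _ v).integrableOn
  · refine Integrable.fintype_prod (f := fun i x => Real.exp ((u i * x - u i ^ 2 / 2) / v))
      fun i => (integrable_exp_shift_gaussianReal _ v).integrableOn
  · exact ae_of_all _ fun x => Finset.prod_nonneg fun i _ => (Real.exp_pos _).le

lemma integral_add_pi_gaussianReal {ι : Type*} [Fintype ι] {v : NNReal} (hv : v ≠ 0)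
    (u : ι → ℝ) {f : (ι → ℝ) → ℝ} (hf : Measurable f) :
    ∫ n, f (u + n) ∂(Measure.pi fun _ : ι => gaussianReal 0 v) =
      ∫ n, gaussianShiftDensity v u n * f n ∂(Measure.pi fun _ : ι => gaussianReal 0 v) := by
  rw [← integral_map (φ := fun n => u + n) (by fun_prop) hf.aestronglyMeasurable,
    map_add_pi_gaussianReal hv,
    integral_withDensity_eq_integral_toReal_smul
      (measurable_gaussianShiftDensity v u).ennreal_ofReal (ae_of_all _ fun _ => by simp)]
  refine integral_congr_ae (ae_of_all _ fun n => ?_)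
  simp [ENNReal.toReal_ofReal (Real.exp_pos _).le, gaussianShiftDensity]

lemma sq_integral_mul_le {Ω : Type*} [MeasurableSpace Ω] {μ : Measure Ω} {f w : Ω → ℝ}
    (hf : MemLp f 2 μ) (hw : MemLp w 2 μ) :
    (∫ x, w x * f x ∂μ) ^ 2 ≤ (∫ x, f x ^ 2 ∂μ) * ∫ x, w x ^ 2 ∂μ := by
  have h : ∀ s : ℝ, 0 ≤ (∫ x, w x ^ 2 ∂μ) * (s * s) + (-2 * ∫ x, w x * f x ∂μ) * s +
      ∫ x, f x ^ 2 ∂μ := by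
    intro s
    have h0 : 0 ≤ ∫ x, (f x - s * w x) ^ 2 ∂μ := integral_nonneg fun x => sq_nonneg _
    have h1 : ∀ x, (f x - s * w x) ^ 2 = s * s * w x ^ 2 + -2 * s * (w x * f x) + f x ^ 2 :=
      fun x => by ring
    have hwf : Integrable (fun x => w x * f x) μ := hw.integrable_mul hf
    simp_rw [h1] at h0
    have hw2 : Integrable (fun x => s * s * w x ^ 2 + -2 * s * (w x * f x)) μ :=
      (hw.integrable_sq.const_mul _).add (hwf.const_mul _)
    rw [integral_add hw2 hf.integrable_sq, integral_add (hw.integrable_sq.const_mul _) (hwf.const_mul _), integral_const_mul,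
      integral_const_mul] at h0
    linarith
  have := discrim_le_zero h
  rw [discrim] at this
  nlinarith

/-- Hammersley–Chapman–Robbins inequality for Gaussian shifts `u + t h_l`, `u ⟂ h_l`. -/
lemma sq_sum_integral_shift_sub_le {ι κ : Type*} [Fintype ι] [Fintype κ] {v : NNReal}
    (hv : v ≠ 0) {f : (ι → ℝ) → ℝ} (hfm : Measurable f)
    (hf : MemLp f 2 (Measure.pi fun _ : ι => gaussianReal 0 v))
    (u : ι → ℝ) (h : κ → ι → ℝ) (huh : ∀ k, u ⬝ᵥ h k = 0) (a : κ → ℝ) (t : ℝ) :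
    (∑ k, a k * ((∫ n, f (u + t • h k + n) ∂(Measure.pi fun _ : ι => gaussianReal 0 v)) -
        ∫ n, f (u + n) ∂(Measure.pi fun _ : ι => gaussianReal 0 v))) ^ 2 ≤
      (∫ n, f n ^ 2 ∂(Measure.pi fun _ : ι => gaussianReal 0 v)) *
        (Real.exp (u ⬝ᵥ u / v) *
          ∑ k, ∑ l, a k * a l * (Real.exp (t ^ 2 * (h k ⬝ᵥ h l) / v) - 1)) := by
  set G := Measure.pi fun _ : ι => gaussianReal 0 v
  set L := gaussianShiftDensity (ι := ι) v
  have hL := memLp_gaussianShiftDensity (ι := ι) v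
  have hd : ∀ k, MemLp (fun n => L (u + t • h k) n - L u n) 2 G := fun k => (hL _).sub (hL _)
  have hw : MemLp (fun n => ∑ k, a k * (L (u + t • h k) n - L u n)) 2 G :=
    memLp_finsetSum _ fun k _ => (hd k).const_mul (a k)
  have key := sq_integral_mul_le hf hw
  have hLL : ∀ p q, Integrable (fun n => L p n * L q n) G := fun p q =>
    (hL p).integrable_mul (hL q)
  have hLf : ∀ p, Integrable (fun n => L p n * f n) G := fun p => (hL p).integrable_mul hf
  have hLd : ∀ p q r, Integrable (fun n => L p n * L q n - L r n * L u n) G := fun p q r =>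
    (hLL p q).sub (hLL r u)
  convert key using 2
  · simp_rw [Finset.sum_mul]
    rw [integral_finsetSum]
    · refine Finset.sum_congr rfl fun k _ => ?_
      simp_rw [mul_assoc]
      rw [integral_const_mul, integral_add_pi_gaussianReal hv _ hfm,
        integral_add_pi_gaussianReal hv _ hfm, ← integral_sub (hLf _) (hLf _)]
      simp_rw [sub_mul]
    · intro k _
      exact ((hd k).const_mul (a k)).integrable_mul hf
  · simp_rw [sq (∑ k, _), Finset.sum_mul_sum]
    rw [integral_finsetSum, Finset.mul_sum]
    · refine Finset.sum_congr rfl fun k _ => ?_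
      rw [integral_finsetSum, Finset.mul_sum]
      · refine Finset.sum_congr rfl fun l _ => ?_
        have e : ∀ n, a k * (L (u + t • h k) n - L u n) * (a l * (L (u + t • h l) n - L u n)) =
            a k * a l * ((L (u + t • h k) n * L (u + t • h l) n - L (u + t • h k) n * L u n) -
              (L u n * L (u + t • h l) n - L u n * L u n)) := fun n => by ring
        simp_rw [e]
        rw [integral_const_mul, integral_sub (hLd _ _ _) (hLd _ _ _),
          integral_sub (hLL _ _) (hLL _ _), integral_sub (hLL _ _) (hLL _ _)]
        simp_rw [G, L, integral_gaussianShiftDensity_mul hv]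
        have hhu : ∀ k, h k ⬝ᵥ u = 0 := fun k => by rw [dotProduct_comm, huh]
        simp only [add_dotProduct, dotProduct_add, smul_dotProduct, dotProduct_smul, huh, hhu,
          smul_eq_mul, mul_zero, add_zero, zero_add, add_div, Real.exp_add]
        ring_nf
      · intro l _
        exact ((hd k).const_mul (a k)).integrable_mul ((hd l).const_mul (a l))
    · intro k _
      exact integrable_finsetSum _ fun l _ =>
        ((hd k).const_mul (a k)).integrable_mul ((hd l).const_mul (a l))

lemma tendsto_exp_sq_mul_sub_one_div_sq (c : ℝ) :
    Filter.Tendsto (fun t : ℝ => (t ^ 2)⁻¹ * (Real.exp (t ^ 2 * c) - 1))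
      (nhdsWithin 0 {0}ᶜ) (nhds c) := by
  have h1 : HasDerivAt (fun s : ℝ => Real.exp (s * c)) c 0 := by
    simpa using ((hasDerivAt_id (0 : ℝ)).mul_const c).exp
  have h2 : Filter.Tendsto (fun t : ℝ => t ^ 2) (nhdsWithin 0 {0}ᶜ) (nhdsWithin 0 {0}ᶜ) := by
    refine tendsto_nhdsWithin_iff.2 ⟨?_, ?_⟩
    · exact ((continuous_pow 2).tendsto' (0 : ℝ) 0 (by simp)).mono_left nhdsWithin_le_nhds
    · filter_upwards [self_mem_nhdsWithin] with t ht
      exact pow_ne_zero 2 ht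
  simpa [Function.comp_def] using h1.tendsto_slope_zero.comp h2

/-- Cramér–Rao inequality at `0` from derivatives of the mean at an orthogonal shift `u`. -/
lemma sq_sum_mul_deriv_le {ι κ : Type*} [Fintype ι] [Fintype κ] {v : NNReal}
    (hv : v ≠ 0) {f : (ι → ℝ) → ℝ} (hfm : Measurable f)
    (hf : MemLp f 2 (Measure.pi fun _ : ι => gaussianReal 0 v))
    (u : ι → ℝ) (h : κ → ι → ℝ) (huh : ∀ k, u ⬝ᵥ h k = 0) (a b : κ → ℝ)
    (hb : ∀ k, HasDerivAt (fun t : ℝ =>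
      ∫ n, f (u + t • h k + n) ∂(Measure.pi fun _ : ι => gaussianReal 0 v)) (b k) 0) :
    (∑ k, a k * b k) ^ 2 ≤
      (∫ n, f n ^ 2 ∂(Measure.pi fun _ : ι => gaussianReal 0 v)) *
        (Real.exp (u ⬝ᵥ u / v) * ∑ k, ∑ l, a k * a l * (h k ⬝ᵥ h l / v)) := by
  have hl := (tendsto_finsetSum Finset.univ fun k _ =>
    (hb k).tendsto_slope_zero.const_mul (a k)).pow 2
  have hr := ((tendsto_finsetSum Finset.univ fun k _ => tendsto_finsetSum Finset.univ fun l _ =>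
    (tendsto_exp_sq_mul_sub_one_div_sq (h k ⬝ᵥ h l / v)).const_mul (a k * a l)).const_mul
      (Real.exp (u ⬝ᵥ u / v))).const_mul
      (∫ n, f n ^ 2 ∂(Measure.pi fun _ : ι => gaussianReal 0 v))
  refine le_of_tendsto_of_tendsto hl hr ?_
  filter_upwards with t
  have key := mul_le_mul_of_nonneg_left (sq_sum_integral_shift_sub_le hv hfm hf u h huh a t)
    (inv_nonneg.2 (sq_nonneg t))
  convert key using 1
  · simp only [zero_add, zero_smul, add_zero, smul_eq_mul]
    rw [← inv_pow, ← mul_pow, Finset.mul_sum]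
    congr 1
    exact Finset.sum_congr rfl fun k _ => by ring
  · rw [mul_left_comm, mul_left_comm (t ^ 2)⁻¹]
    simp_rw [Finset.mul_sum]
    refine Finset.sum_congr rfl fun k _ => Finset.sum_congr rfl fun l _ => ?_
    rw [mul_div_assoc]
    ring

lemma integral_slgmP {M N : ℕ} (H : Matrix (Fin M) (Fin N) ℝ) (σ : ℝ) (x : Fin N → ℝ)
    {f : (Fin M → ℝ) → ℝ} (hf : Measurable f) :
    ∫ y, f y ∂slgmP H σ x = ∫ n, f (H.mulVec x + n)
      ∂(Measure.pi fun _ : Fin M => gaussianReal 0 ((σ ^ 2).toNNReal)) :=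
  integral_map (by fun_prop) hf.aestronglyMeasurable

lemma integrable_slgmP {M N : ℕ} (H : Matrix (Fin M) (Fin N) ℝ) (σ : ℝ) (x : Fin N → ℝ)
    {f : (Fin M → ℝ) → ℝ} (hf : Measurable f) :
    Integrable f (slgmP H σ x) ↔ Integrable (fun n => f (H.mulVec x + n))
      (Measure.pi fun _ : Fin M => gaussianReal 0 ((σ ^ 2).toNNReal)) :=
  integrable_map_measure hf.aestronglyMeasurable (by fun_prop)

lemma isUnit_det_gramK {M N : ℕ} (H : Matrix (Fin M) (Fin N) ℝ) (K : Finset (Fin N))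
    (hK : LinearIndependent ℝ (fun k : ↥K => fun m => H m k.1)) :
    IsUnit (gramK H K).det := by
  have hinj : Function.Injective (Hsub H K).mulVec := Matrix.mulVec_injective_iff.2 hK
  have := (Matrix.PosDef.conjTranspose_mul_self (Hsub H K) hinj).isUnit
  rw [Matrix.isUnit_iff_isUnit_det] at this
  simpa [gramK, Matrix.conjTranspose_eq_transpose_of_trivial] using this

lemma mulVec_xtilde {M N : ℕ} (H : Matrix (Fin M) (Fin N) ℝ) (K : Finset (Fin N))
    (x : Fin N → ℝ) : H.mulVec (xtilde H K x) = (projK H K).mulVec (H.mulVec x) := by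
  rw [projK, Matrix.mul_assoc, ← Matrix.mulVec_mulVec]
  set w := ((gramK H K)⁻¹ * (Hsub H K)ᵀ).mulVec (H.mulVec x) with hw
  ext m
  change ∑ i, H m i * xtilde H K x i = ∑ k : ↥K, H m k * w k
  rw [← Finset.sum_subset (Finset.subset_univ K) fun i _ hi => by simp [xtilde, hi],
    ← Finset.sum_coe_sort]
  exact Finset.sum_congr rfl fun k _ => by simp only [xtilde, dif_pos k.2, hw]

lemma support_xtilde_add_single_subset {M N : ℕ} (H : Matrix (Fin M) (Fin N) ℝ)
    (K : Finset (Fin N)) (x : Fin N → ℝ) {l : Fin N} (hl : l ∈ K) (t : ℝ) :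
    Function.support (xtilde H K x + t • (Pi.single l (1 : ℝ) : Fin N → ℝ)) ⊆ K := by
  intro i hi
  by_contra hiK
  have hil : i ≠ l := fun h => hiK (h ▸ hl)
  have hiK' : i ∉ K := hiK
  simp [xtilde, hiK', hil] at hi

lemma projK_sub_dotProduct_Hsub {M N : ℕ} (H : Matrix (Fin M) (Fin N) ℝ) (K : Finset (Fin N))
    (hG : IsUnit (gramK H K).det) (y : Fin M → ℝ) (k : ↥K) :
    ((projK H K).mulVec y - y) ⬝ᵥ (fun m => Hsub H K m k) = 0 := by
  have h : (Hsub H K)ᵀ.mulVec ((projK H K).mulVec y - y) = 0 := by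
    rw [Matrix.mulVec_sub, Matrix.mulVec_mulVec, projK, ← Matrix.mul_assoc, ← Matrix.mul_assoc]
    change ((gramK H K) * (gramK H K)⁻¹ * (Hsub H K)ᵀ).mulVec y - _ = 0
    rw [Matrix.mul_nonsing_inv _ hG, Matrix.one_mul, sub_self]
  rw [dotProduct_comm]
  exact congrFun h k

/-- Modified CRB-type bound. With `P = H_K (H_KᵀH_K)⁻¹ H_Kᵀ` and
`x̃₀` the vector supported on `K` with `H x̃₀ = P H x₀`, and `b_l` the partial
derivatives of the mean function at `x̃₀` along `e_l`, `l ∈ K`, one has `H_KᵀH_K`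
invertible and `v(ĝ;x₀) ≥ exp(−‖(I−P)Hx₀‖²/σ²) · σ² bᵀ(H_KᵀH_K)⁻¹ b`. -/
theorem slgm_modified_crb_type_bound {N M S : ℕ} (hN : 1 ≤ N) (hM : 1 ≤ M)
    (hS1 : 1 ≤ S) (hSN : S ≤ N)
    (H : Matrix (Fin M) (Fin N) ℝ) (σ : ℝ) (hσ : 0 < σ)
    (hspark : ∀ K : Finset (Fin N), K.card ≤ S →
      LinearIndependent ℝ (fun k : ↥K => fun m => H m k.1))
    (x₀ : Fin N → ℝ) (hx₀ : x₀ ∈ sparseSet N S)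
    (K : Finset (Fin N)) (hKne : K.Nonempty) (hKS : K.card ≤ S)
    (g : (Fin M → ℝ) → ℝ) (hg : Measurable g)
    (hint : ∀ x ∈ sparseSet N S, Integrable g (slgmP H σ x))
    (hsq : Integrable (fun y => g y ^ 2) (slgmP H σ x₀))
    (b : Fin N → ℝ)
    (hder : ∀ l ∈ K, HasDerivAt
      (fun t : ℝ => slgmMean H σ g (xtilde H K x₀ + t • (Pi.single l (1:ℝ) : Fin N → ℝ)))
      (b l) 0) :
    IsUnit (gramK H K).det ∧
    Real.exp (-(∑ m, (H.mulVec x₀ - (projK H K).mulVec (H.mulVec x₀)) m ^ 2) / σ ^ 2) *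
        (σ ^ 2 * ∑ k : ↥K, ∑ l : ↥K, b k.1 * (gramK H K)⁻¹ k l * b l.1)
      ≤ slgmVar H σ g x₀ := by
  have hG := isUnit_det_gramK H K (hspark K hKS)
  refine ⟨hG, ?_⟩
  set v := (σ ^ 2).toNNReal with hvdef
  have hvσ : (v : ℝ) = σ ^ 2 := Real.coe_toNNReal _ (sq_nonneg σ)
  have hv : v ≠ 0 := by
    rw [← NNReal.coe_ne_zero, hvσ]; positivity
  set c := slgmMean H σ g x₀ with hc
  set f : (Fin M → ℝ) → ℝ := fun n => g (H.mulVec x₀ + n) - c with hfdef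
  have hfm : Measurable f := by fun_prop
  have hf : MemLp f 2 (Measure.pi fun _ : Fin M => gaussianReal 0 v) := by
    refine MemLp.sub ?_ (memLp_const c)
    rw [memLp_two_iff_integrable_sq (Measurable.aestronglyMeasurable (by fun_prop))]
    exact (integrable_slgmP H σ x₀ (by fun_prop)).1 hsq
  set u := (projK H K).mulVec (H.mulVec x₀) - H.mulVec x₀ with hu
  set h : ↥K → Fin M → ℝ := fun k m => Hsub H K m k with hh
  have hmul : ∀ k : ↥K, ∀ t : ℝ,
      H.mulVec (xtilde H K x₀ + t • (Pi.single k.1 (1 : ℝ) : Fin N → ℝ)) =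
        H.mulVec x₀ + (u + t • h k) := by
    intro k t
    rw [Matrix.mulVec_add, mulVec_xtilde, Matrix.mulVec_smul, Matrix.mulVec_single_one]
    ext m
    simp only [hu, hh, Hsub, Pi.add_apply, Pi.sub_apply, Pi.smul_apply, smul_eq_mul,
      Matrix.of_apply, Matrix.col_apply]
    ring
  have hb : ∀ k : ↥K, HasDerivAt (fun t : ℝ =>
      ∫ n, f (u + t • h k + n) ∂(Measure.pi fun _ : Fin M => gaussianReal 0 v)) (b k.1) 0 := by
    intro k
    refine ((hder k.1 k.2).sub_const c).congr_of_eventuallyEq (Filter.Eventually.of_forall ?_)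
    intro t
    have hx : xtilde H K x₀ + t • (Pi.single k.1 (1 : ℝ) : Fin N → ℝ) ∈ sparseSet N S := by
      refine (Set.ncard_le_ncard (support_xtilde_add_single_subset H K x₀ k.2 t)
        K.finite_toSet).trans ?_
      rwa [Set.ncard_coe_finset]
    have hi := (integrable_slgmP H σ _ hg).1 (hint _ hx)
    simp only [slgmMean, integral_slgmP H σ _ hg, hfdef]
    simp_rw [hmul, add_assoc] at hi ⊢
    rw [integral_sub hi (integrable_const c)]
    simp
  set a : ↥K → ℝ := (gramK H K)⁻¹.mulVec (fun k => b k.1) with ha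
  have key := sq_sum_mul_deriv_le hv hfm hf u h
    (projK_sub_dotProduct_Hsub H K hG (H.mulVec x₀)) a (fun k => b k.1) hb
  have hV : slgmVar H σ g x₀ =
      ∫ n, f n ^ 2 ∂(Measure.pi fun _ : Fin M => gaussianReal 0 v) :=
    integral_slgmP H σ x₀ (f := fun y => (g y - c) ^ 2) (by fun_prop)
  have hV0 : 0 ≤ slgmVar H σ g x₀ := integral_nonneg fun _ => sq_nonneg _
  have hQ : ∑ k : ↥K, ∑ l : ↥K, b k.1 * (gramK H K)⁻¹ k l * b l.1 = ∑ k, a k * b k.1 := by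
    refine Finset.sum_congr rfl fun k _ => ?_
    rw [ha, Matrix.mulVec, dotProduct, Finset.sum_mul]
    exact Finset.sum_congr rfl fun l _ => by ring
  have hGa : (gramK H K).mulVec a = fun k => b k.1 := by
    rw [ha, Matrix.mulVec_mulVec, Matrix.mul_nonsing_inv _ hG, Matrix.one_mulVec]
  have hQ' : ∑ k, ∑ l, a k * a l * (h k ⬝ᵥ h l / v) = (∑ k, a k * b k.1) / σ ^ 2 := by
    rw [Finset.sum_div]
    refine Finset.sum_congr rfl fun k _ => ?_
    rw [← congrFun hGa k, Matrix.mulVec, dotProduct, Finset.mul_sum, Finset.sum_div, hvσ]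
    refine Finset.sum_congr rfl fun l _ => ?_
    have : h k ⬝ᵥ h l = gramK H K k l := rfl
    rw [this]
    ring
  have huu : ∑ m, (H.mulVec x₀ - (projK H K).mulVec (H.mulVec x₀)) m ^ 2 = u ⬝ᵥ u := by
    refine Finset.sum_congr rfl fun m _ => ?_
    simp only [hu, Pi.sub_apply]
    ring
  rw [← hV, hQ', hvσ] at key
  rw [hQ, huu, neg_div, Real.exp_neg]
  set Q := ∑ k, a k * b k.1
  set E := Real.exp (u ⬝ᵥ u / σ ^ 2)
  have hE : 0 < E := Real.exp_pos _
  rcases le_or_gt Q 0 with hQ0 | hQ0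
  · refine le_trans ?_ hV0
    exact mul_nonpos_of_nonneg_of_nonpos (inv_pos.2 hE).le
      (mul_nonpos_of_nonneg_of_nonpos (sq_nonneg σ) hQ0)
  · rw [inv_mul_le_iff₀ hE]
    have h1 : Q * (σ ^ 2 * Q) ≤ Q * (E * slgmVar H σ g x₀) := by
      have := mul_le_mul_of_nonneg_left key (sq_nonneg σ)
      have e : σ ^ 2 * (slgmVar H σ g x₀ * (E * (Q / σ ^ 2))) = Q * (E * slgmVar H σ g x₀) := by
        field_simp
      rw [e] at this
      linarith
    exact le_of_mul_le_mul_left h1 hQ0
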